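/- arXiv:1305.4568 — 2 statements merged into one kernel-verified Lean document; each statement's English description precedes it below -/
import Mathlib

section
/- If a bounded linear operator Â on L²_M commutes with the operator of multiplication by e^{-in·k} for every n ∈ ℤ^N, then Â commutes with the operator of multiplication by r for every essentially bounded measurable scalar function r : [-π,π]^N → ℂ, i.e. Â(r f̂) = r (Â f̂) for all f̂ ∈ L²_M. -/
open MeasureTheory

noncomputable section

/-- The box `[-π, π]^N`. -/
def box (N : ℕ) : Set (Fin N → ℝ) := Set.univ.pi fun _ => Set.Icc (-Real.pi) Real.pi

/-- Lebesgue measure restricted to the box `[-π, π]^N`. -/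
def boxMeasure (N : ℕ) : Measure (Fin N → ℝ) := MeasureTheory.volume.restrict (box N)

/-- `L²_M`: square-integrable `ℂ^M`-valued functions on `[-π, π]^N`. -/
abbrev L2M (N M : ℕ) : Type := MeasureTheory.Lp (EuclideanSpace ℂ (Fin M)) 2 (boxMeasure N)

/-- `ℓ²(ℤ^N, ℂ^M)`. -/
abbrev ell2 (N M : ℕ) : Type := lp (fun _ : Fin N → ℤ => EuclideanSpace ℂ (Fin M)) 2

/-- The values of the Bloch–Floquet transform:
`(F h)(k) = (2π)^{-N/2} Σ_{n ∈ ℤ^N} h(n) e^{i n·k}`. -/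
def blochFormula {N M : ℕ} (h : (Fin N → ℤ) → EuclideanSpace ℂ (Fin M)) (k : Fin N → ℝ) :
    EuclideanSpace ℂ (Fin M) :=
  ((2 * Real.pi) ^ ((N : ℝ) / 2))⁻¹ •
    ∑' n : Fin N → ℤ, Complex.exp (Complex.I * ∑ i, (n i : ℂ) * (k i : ℂ)) • h n

open scoped BoundedContinuousFunction ComplexConjugate InnerProductSpace

section Determining

variable {E : Type*} [TopologicalSpace E] [PolishSpace E] [MeasurableSpace E] [BorelSpace E]
  {μ : Measure E} {A : StarSubalgebra ℂ (E →ᵇ ℂ)}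

/-- An integrable real function that is orthogonal to a point-separating star subalgebra of bounded
continuous functions vanishes almost everywhere. -/
theorem ae_eq_zero_of_forall_mem_starSubalgebra_integral_mul_ofReal_eq_zero
    (hA : (A.map (BoundedContinuousFunction.toContinuousMapStarₐ ℂ)).SeparatesPoints)
    {v : E → ℝ} (hv : Integrable v μ) (h : ∀ g ∈ A, ∫ x, g x * (v x : ℂ) ∂μ = 0) :
    v =ᵐ[μ] 0 := by
  have hP := isFiniteMeasure_withDensity_ofReal hv.2
  have hP' := isFiniteMeasure_withDensity_ofReal hv.neg.2
  have hm : AEMeasurable (fun x => ENNReal.ofReal (v x)) μ := hv.aemeasurable.ennreal_ofReal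
  have hm' : AEMeasurable (fun x => ENNReal.ofReal ((-v) x)) μ :=
    hv.neg.aemeasurable.ennreal_ofReal
  have hint : ∀ (g : E →ᵇ ℂ) (w : E → ℝ), Integrable w μ →
      Integrable (fun x => (ENNReal.ofReal (w x)).toReal • g x) μ := by
    intro g w hw
    have hw' : Integrable (fun x => (ENNReal.ofReal (w x)).toReal) μ := by
      simpa [ENNReal.toReal_ofReal'] using hw.pos_part
    exact hw'.smul_bdd ‖g‖ g.continuous.aestronglyMeasurable
      (Filter.Eventually.of_forall g.norm_coe_le_norm)
  have heq : μ.withDensity (fun x => ENNReal.ofReal (v x)) =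
      μ.withDensity (fun x => ENNReal.ofReal ((-v) x)) := by
    refine ext_of_forall_mem_subalgebra_integral_eq_of_polish hA fun g hg => ?_
    rw [integral_withDensity_eq_integral_toReal_smul₀ hm (by simp),
      integral_withDensity_eq_integral_toReal_smul₀ hm' (by simp), ← sub_eq_zero,
      ← integral_sub (hint g v hv) (hint g (-v) hv.neg), ← h g hg]
    refine integral_congr_ae (Filter.Eventually.of_forall fun x => ?_)
    simp only [ENNReal.toReal_ofReal', Pi.neg_apply, Complex.real_smul]
    rcases le_total (v x) 0 with hx | hx <;> simp [hx, mul_comm]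
  have hae := (withDensity_eq_iff hm hm' hv.lintegral_lt_top.ne).1 heq
  filter_upwards [hae] with x hx
  have hx' := congrArg ENNReal.toReal hx
  simp only [ENNReal.toReal_ofReal', Pi.neg_apply] at hx'
  rcases le_total (v x) 0 with h0 | h0 <;> simp_all

/-- An integrable complex function that is orthogonal to a point-separating star subalgebra of
bounded continuous functions vanishes almost everywhere. -/
theorem ae_eq_zero_of_forall_mem_starSubalgebra_integral_mul_eq_zero
    (hA : (A.map (BoundedContinuousFunction.toContinuousMapStarₐ ℂ)).SeparatesPoints)
    {u : E → ℂ} (hu : Integrable u μ) (h : ∀ g ∈ A, ∫ x, g x * u x ∂μ = 0) :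
    u =ᵐ[μ] 0 := by
  have hstar : ∀ g ∈ A, ∫ x, g x * conj (u x) ∂μ = 0 := by
    intro g hg
    have := congrArg conj (h (star g) (star_mem hg))
    rw [← integral_conj] at this
    simpa using this
  have hi : ∀ g : E →ᵇ ℂ, Integrable (fun x => g x * u x) μ := fun g =>
    hu.bdd_mul g.continuous.aestronglyMeasurable
      (Filter.Eventually.of_forall g.norm_coe_le_norm)
  have hc : Integrable (fun x => conj (u x)) μ :=
    (Complex.conjLIE.integrable_comp_iff).2 hu
  have hi' : ∀ g : E →ᵇ ℂ, Integrable (fun x => g x * conj (u x)) μ := fun g =>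
    hc.bdd_mul g.continuous.aestronglyMeasurable
      (Filter.Eventually.of_forall g.norm_coe_le_norm)
  have hre : (fun x => (u x).re) =ᵐ[μ] 0 := by
    refine ae_eq_zero_of_forall_mem_starSubalgebra_integral_mul_ofReal_eq_zero hA hu.re
      fun g hg => ?_
    have : ∀ x, g x * ((u x).re : ℂ) = (g x * u x + g x * conj (u x)) / 2 := fun x => by
      rw [Complex.re_eq_add_conj]; ring
    simp_rw [this]
    rw [integral_div, integral_add (hi g) (hi' g), h g hg, hstar g hg]
    simp
  have him : (fun x => (u x).im) =ᵐ[μ] 0 := by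
    refine ae_eq_zero_of_forall_mem_starSubalgebra_integral_mul_ofReal_eq_zero hA hu.im
      fun g hg => ?_
    have : ∀ x, g x * ((u x).im : ℂ) = (g x * u x - g x * conj (u x)) / (2 * Complex.I) :=
      fun x => by rw [Complex.im_eq_sub_conj]; ring
    simp_rw [this]
    rw [integral_div, integral_sub (hi g) (hi' g), h g hg, hstar g hg]
    simp
  filter_upwards [hre, him] with x h1 h2
  exact Complex.ext h1 h2

end Determining

section Characters

variable {N : ℕ}

theorem norm_exp_neg_I_mul_sum (n : Fin N → ℤ) (k : Fin N → ℝ) :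
    ‖Complex.exp (-Complex.I * ∑ i, (n i : ℂ) * (k i : ℂ))‖ = 1 := by
  have : -Complex.I * ∑ i, (n i : ℂ) * (k i : ℂ) = ((-∑ i, (n i : ℝ) * k i : ℝ) : ℂ) * Complex.I := by
    push_cast; ring
  rw [this, Complex.norm_exp_ofReal_mul_I]

theorem continuous_exp_neg_I_mul_sum (n : Fin N → ℤ) :
    Continuous fun k : Fin N → ℝ => Complex.exp (-Complex.I * ∑ i, (n i : ℂ) * (k i : ℂ)) := by
  fun_prop

/-- The open box `(-π, π)^N`. -/
def openBox (N : ℕ) : Set (Fin N → ℝ) := Set.univ.pi fun _ => Set.Ioo (-Real.pi) Real.pi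

theorem isOpen_openBox (N : ℕ) : IsOpen (openBox N) :=
  isOpen_set_pi Set.finite_univ fun _ _ => isOpen_Ioo

theorem boxMeasure_eq_restrict_openBox (N : ℕ) :
    boxMeasure N = volume.restrict (openBox N) :=
  (Measure.restrict_congr_set Measure.pi_Ioo_ae_eq_pi_Icc).symm

/-- The character `k ↦ e^{-i n·k}` as a bounded continuous function on the open box. -/
def openBoxChar (n : Fin N → ℤ) : openBox N →ᵇ ℂ :=
  BoundedContinuousFunction.ofNormedAddCommGroup
    (fun k : openBox N => Complex.exp (-Complex.I * ∑ i, (n i : ℂ) * ((k : Fin N → ℝ) i : ℂ)))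
    ((continuous_exp_neg_I_mul_sum n).comp continuous_subtype_val) 1
    fun k => (norm_exp_neg_I_mul_sum n k).le

theorem openBoxChar_apply (n : Fin N → ℤ) (k : openBox N) :
    openBoxChar n k = Complex.exp (-Complex.I * ∑ i, (n i : ℂ) * ((k : Fin N → ℝ) i : ℂ)) := rfl

theorem openBoxChar_zero : openBoxChar (0 : Fin N → ℤ) = 1 := by
  ext k
  simp [openBoxChar_apply]

theorem openBoxChar_add (m n : Fin N → ℤ) :
    openBoxChar (m + n) = openBoxChar m * openBoxChar n := by
  ext k
  simp [openBoxChar_apply, ← Complex.exp_add, add_mul, Finset.sum_add_distrib, mul_add]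

theorem openBoxChar_neg (n : Fin N → ℤ) : openBoxChar (-n) = star (openBoxChar n) := by
  ext k
  simp [openBoxChar_apply, ← Complex.exp_conj]

/-- The star algebra of trigonometric polynomials on the open box. -/
def openBoxTrigPoly (N : ℕ) : StarSubalgebra ℂ (openBox N →ᵇ ℂ) where
  toSubalgebra := Algebra.adjoin ℂ (Set.range openBoxChar)
  star_mem' := by
    change Algebra.adjoin ℂ (Set.range openBoxChar) ≤
      star (Algebra.adjoin ℂ (Set.range openBoxChar))
    refine Algebra.adjoin_le ?_
    rintro _ ⟨n, rfl⟩
    exact Algebra.subset_adjoin ⟨-n, openBoxChar_neg n⟩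

theorem openBoxTrigPoly_toSubmodule (N : ℕ) :
    Subalgebra.toSubmodule (openBoxTrigPoly N).toSubalgebra =
      Submodule.span ℂ (Set.range openBoxChar) := by
  apply Algebra.adjoin_eq_span_of_subset
  refine .trans (fun x => Submonoid.closure_induction (fun _ => id) ⟨0, openBoxChar_zero⟩ ?_)
    Submodule.subset_span
  rintro _ _ _ _ ⟨m, rfl⟩ ⟨n, rfl⟩
  exact ⟨m + n, openBoxChar_add m n⟩

theorem openBoxTrigPoly_separatesPoints (N : ℕ) :
    ((openBoxTrigPoly N).map
      (BoundedContinuousFunction.toContinuousMapStarₐ ℂ)).SeparatesPoints := by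
  classical
  intro x y hxy
  obtain ⟨i, hi⟩ : ∃ i, (x : Fin N → ℝ) i ≠ (y : Fin N → ℝ) i := by
    by_contra! hne
    exact hxy (Subtype.ext (funext hne))
  refine ⟨_, ⟨_, ⟨openBoxChar (Pi.single i 1), Algebra.subset_adjoin ⟨_, rfl⟩, rfl⟩, rfl⟩, ?_⟩
  have hval : ∀ z : openBox N,
      openBoxChar (Pi.single i 1) z = Complex.exp (-Complex.I * ((z : Fin N → ℝ) i : ℂ)) := by
    intro z
    simp [openBoxChar_apply, Pi.single_apply]
  change openBoxChar (Pi.single i 1) x ≠ openBoxChar (Pi.single i 1) y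
  rw [hval, hval]
  intro he
  obtain ⟨n, hn⟩ := Complex.exp_eq_exp_iff_exists_int.1 he
  have hn' : (y : Fin N → ℝ) i - (x : Fin N → ℝ) i = n * (2 * Real.pi) := by
    have h2 : (((y : Fin N → ℝ) i - (x : Fin N → ℝ) i : ℝ) : ℂ) * Complex.I =
        ((n * (2 * Real.pi) : ℝ) : ℂ) * Complex.I := by
      push_cast
      linear_combination hn
    exact_mod_cast mul_right_cancel₀ Complex.I_ne_zero h2
  have hx := x.2 i (Set.mem_univ i)
  have hy := y.2 i (Set.mem_univ i)
  have hpi := Real.pi_pos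
  have h1 : (n : ℝ) < 1 := by
    by_contra! hge
    nlinarith [hx.1, hy.2]
  have h2 : (-1 : ℝ) < n := by
    by_contra! hge
    nlinarith [hx.2, hy.1]
  have hn0 : n = 0 := by
    have h1' : n < 1 := by exact_mod_cast h1
    have h2' : -1 < n := by exact_mod_cast h2
    omega
  rw [hn0] at hn'
  simp only [Int.cast_zero, zero_mul] at hn'
  exact hi (by linarith)

/-- An integrable function on the box all of whose Fourier coefficients vanish is zero almost
everywhere. -/
theorem ae_eq_zero_of_forall_integral_exp_mul_eq_zero {u : (Fin N → ℝ) → ℂ}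
    (hu : Integrable u (boxMeasure N))
    (h : ∀ n : Fin N → ℤ, ∫ k, Complex.exp (-Complex.I * ∑ i, (n i : ℂ) * (k i : ℂ)) * u k
      ∂(boxMeasure N) = 0) :
    u =ᵐ[boxMeasure N] 0 := by
  have hms := (isOpen_openBox N).measurableSet
  have : PolishSpace (openBox N) := (isOpen_openBox N).polishSpace
  rw [boxMeasure_eq_restrict_openBox] at hu h ⊢
  refine (ae_restrict_iff_subtype hms).2 ?_
  have hu' : Integrable (fun k : openBox N => u k) (volume.comap Subtype.val) := by
    rw [← map_comap_subtype_coe hms] at hu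
    exact (MeasurableEmbedding.subtype_coe hms).integrable_map_iff.1 hu
  refine ae_eq_zero_of_forall_mem_starSubalgebra_integral_mul_eq_zero
    (openBoxTrigPoly_separatesPoints N) hu' fun g hg => ?_
  have hi : ∀ g : openBox N →ᵇ ℂ,
      Integrable (fun k : openBox N => g k * u k) (volume.comap Subtype.val) := fun g =>
    hu'.bdd_mul g.continuous.aestronglyMeasurable
      (Filter.Eventually.of_forall g.norm_coe_le_norm)
  have hg' : g ∈ Submodule.span ℂ (Set.range openBoxChar) := by
    rw [← openBoxTrigPoly_toSubmodule]
    exact hg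
  clear hg
  induction hg' using Submodule.span_induction with
  | mem g hg =>
    obtain ⟨n, rfl⟩ := hg
    rw [← h n, ← integral_subtype_comap hms]
    rfl
  | zero => simp
  | add g₁ g₂ h₁ h₂ ih₁ ih₂ =>
    simp only [BoundedContinuousFunction.coe_add, Pi.add_apply, add_mul]
    rw [integral_add (hi g₁) (hi g₂)]
    rw [ih₁, ih₂, add_zero]
  | smul c g h₁ ih =>
    simp only [BoundedContinuousFunction.coe_smul, smul_eq_mul, mul_assoc]
    rw [integral_const_mul, ih, mul_zero]

end Characters

section Multiplication

variable {α F : Type*} [MeasurableSpace α] {μ : Measure α} [NormedAddCommGroup F]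
  [InnerProductSpace ℂ F]

theorem memLp_smul_of_ae_norm_le {r : α → ℂ} (hr : AEStronglyMeasurable r μ) {C : ℝ}
    (hC : ∀ᵐ k ∂μ, ‖r k‖ ≤ C) (f : Lp F 2 μ) : MemLp (fun k => r k • f k) 2 μ := by
  refine (Lp.memLp f).of_le_mul (c := C) (hr.smul (Lp.aestronglyMeasurable f)) ?_
  filter_upwards [hC] with k hk
  rw [norm_smul]
  gcongr

theorem inner_eq_integral_mul_of_ae_eq_smul {r : α → ℂ} {f g : Lp F 2 μ}
    (hg : g =ᵐ[μ] fun k => r k • f k) (h : Lp F 2 μ) :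
    ⟪h, g⟫_ℂ = ∫ k, r k * ⟪h k, f k⟫_ℂ ∂μ := by
  rw [L2.inner_def]
  refine integral_congr_ae ?_
  filter_upwards [hg] with k hk
  rw [hk, inner_smul_right]

/-- The difference of the matrix coefficients of `T ∘ r` and `r ∘ T` is the integral of `r` against
a function that does not depend on `r`. -/
theorem inner_map_sub_inner_eq_integral_mul [CompleteSpace F] (T : Lp F 2 μ →L[ℂ] Lp F 2 μ)
    {r : α → ℂ} (hr : AEStronglyMeasurable r μ) {C : ℝ} (hC : ∀ᵐ k ∂μ, ‖r k‖ ≤ C)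
    {f g w : Lp F 2 μ} (hg : g =ᵐ[μ] fun k => r k • f k) (hw : w =ᵐ[μ] fun k => r k • T f k)
    (h : Lp F 2 μ) :
    ⟪h, T g⟫_ℂ - ⟪h, w⟫_ℂ =
      ∫ k, r k * (⟪T.adjoint h k, f k⟫_ℂ - ⟪h k, T f k⟫_ℂ) ∂μ := by
  rw [← ContinuousLinearMap.adjoint_inner_left, inner_eq_integral_mul_of_ae_eq_smul hg,
    inner_eq_integral_mul_of_ae_eq_smul hw, ← integral_sub]
  · simp_rw [mul_sub]
  · exact (L2.integrable_inner _ _).bdd_mul hr hC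
  · exact (L2.integrable_inner _ _).bdd_mul hr hC

end Multiplication

/-- if a bounded operator `Â` on `L²_M` commutes with multiplication by
`e^{-i n·k}` for every `n ∈ ℤ^N`, then it commutes with multiplication by every
essentially bounded measurable scalar function `r`. (Multiplication by a bounded function
is encoded relationally: `g` is the product `r • f` iff `g = (fun k => r k • f k)` a.e.) -/
theorem commutes_with_characters_implies_commutes_with_Linfty (N M : ℕ) (hN : 0 < N) (hM : 0 < M)
    (T : L2M N M →L[ℂ] L2M N M)
    (hcomm : ∀ (n : Fin N → ℤ) (f g : L2M N M),
      (⇑g =ᵐ[boxMeasure N]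
        fun k => Complex.exp (-Complex.I * ∑ i, (n i : ℂ) * (k i : ℂ)) • f k) →
      ⇑(T g) =ᵐ[boxMeasure N]
        fun k => Complex.exp (-Complex.I * ∑ i, (n i : ℂ) * (k i : ℂ)) • (T f) k) :
    ∀ r : (Fin N → ℝ) → ℂ, Measurable r → (∃ C : ℝ, ∀ᵐ k ∂(boxMeasure N), ‖r k‖ ≤ C) →
      ∀ f g : L2M N M, (⇑g =ᵐ[boxMeasure N] fun k => r k • f k) →
        ⇑(T g) =ᵐ[boxMeasure N] fun k => r k • (T f) k := by
  rintro r hr ⟨C, hC⟩ f g hg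
  have hw := (memLp_smul_of_ae_norm_le hr.aestronglyMeasurable hC (T f)).coeFn_toLp
  suffices hTg : T g = (memLp_smul_of_ae_norm_le hr.aestronglyMeasurable hC (T f)).toLp by
    rwa [hTg]
  refine ext_inner_left ℂ fun h => ?_
  rw [← sub_eq_zero, inner_map_sub_inner_eq_integral_mul T hr.aestronglyMeasurable hC hg hw]
  have hzero : (fun k => ⟪T.adjoint h k, f k⟫_ℂ - ⟪h k, T f k⟫_ℂ) =ᵐ[boxMeasure N] 0 := by
    refine ae_eq_zero_of_forall_integral_exp_mul_eq_zero
      ((L2.integrable_inner _ _).sub (L2.integrable_inner _ _)) fun n => ?_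
    have hm := (continuous_exp_neg_I_mul_sum n).aestronglyMeasurable (μ := boxMeasure N)
    have hb : ∀ᵐ k ∂(boxMeasure N),
        ‖Complex.exp (-Complex.I * ∑ i, (n i : ℂ) * (k i : ℂ))‖ ≤ 1 :=
      Filter.Eventually.of_forall fun k => (norm_exp_neg_I_mul_sum n k).le
    have hgn := (memLp_smul_of_ae_norm_le hm hb f).coeFn_toLp
    rw [← inner_map_sub_inner_eq_integral_mul T hm hb hgn (hcomm n f _ hgn), sub_self]
  refine integral_eq_zero_of_ae ?_
  filter_upwards [hzero] with k hk
  simp only [hk, Pi.zero_apply, mul_zero]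
end
end

section
/- (Proposition 3.1(i)) Let 1 ≤ j ≤ N, let P_j be the projection onto the sublattice {n ∈ ℤ^N : n₁ = ⋯ = n_j = 0}, and let 𝒜_j be a bounded linear operator on ℓ²(ℤ^N, ℂ^M) satisfying P_j 𝒜_j P_j = 𝒜_j and commuting with S_n for every n ∈ ℤ^N with n₁ = ⋯ = n_j = 0. Then there exists an M×M matrix-valued function A_j(k) with essentially bounded entries, not depending on the variables k₁,…,k_j, such that for every f̂ ∈ L²_M, (F 𝒜_j F^{-1} f̂)(k) = A_j(k) · ⟨f̂⟩_{1…j}(k_{j+1},…,k_N) for a.e. k. -/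
open MeasureTheory

noncomputable section

/-- The (unnormalized) partial integral over the first `j` variables:
`(pint j f)(k) = ∫_{[-π,π]^j} f(t₁,…,t_j,k_{j+1},…,k_N) dt₁⋯dt_j`. -/
def pint {N M : ℕ} (j : ℕ) (f : (Fin N → ℝ) → EuclideanSpace ℂ (Fin M))
    (k : Fin N → ℝ) : EuclideanSpace ℂ (Fin M) :=
  ∫ t : Fin j → ℝ in (Set.univ.pi fun _ => Set.Icc (-Real.pi) Real.pi),
    f fun i => if h : (i : ℕ) < j then t ⟨(i : ℕ), h⟩ else k i

/-- The normalized partial average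
`⟨f⟩_{1…j}(k) = (2π)^{-j/2} ∫_{[-π,π]^j} f(t₁,…,t_j,k_{j+1},…,k_N) dt₁⋯dt_j`. -/
def navg {N M : ℕ} (j : ℕ) (f : (Fin N → ℝ) → EuclideanSpace ℂ (Fin M))
    (k : Fin N → ℝ) : EuclideanSpace ℂ (Fin M) :=
  ((2 * Real.pi) ^ ((j : ℝ) / 2))⁻¹ • pint j f k

/-- The elementwise description of the sublattice `{n : n₁ = ⋯ = n_j = 0}`. -/
def InSublattice {N : ℕ} (j : ℕ) (n : Fin N → ℤ) : Prop := ∀ i : Fin N, (i : ℕ) < j → n i = 0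

open Classical in
/-- The projection onto functions supported on the sublattice `{n : n₁ = ⋯ = n_j = 0}`. -/
def sublatticeProj (N M j : ℕ) : ell2 N M →L[ℂ] ell2 N M :=
  LinearMap.mkContinuous
    { toFun := fun h => ⟨fun n => if InSublattice j n then h n else 0,
        (lp.memℓp h).mono' fun n => by split_ifs <;> simp⟩
      map_add' := fun f g => by
        ext1; funext n
        change (if InSublattice j n then f n + g n else 0) =
          (if InSublattice j n then f n else 0) + (if InSublattice j n then g n else 0)
        split_ifs <;> simp
      map_smul' := fun c f => by
        ext1; funext n; by_cases hn : InSublattice j n <;> simp [hn] }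
    1 fun h => by
      rw [one_mul]
      refine lp.norm_mono (by norm_num) fun n => ?_
      by_cases hn : InSublattice j n <;> simp [hn]

theorem sublatticeProj_apply_of_mem {N M j : ℕ} (h : ell2 N M) {n : Fin N → ℤ}
    (hn : InSublattice j n) : sublatticeProj N M j h n = h n := if_pos hn

theorem sublatticeProj_apply_of_notMem {N M j : ℕ} (h : ell2 N M) {n : Fin N → ℤ}
    (hn : ¬ InSublattice j n) : sublatticeProj N M j h n = 0 := if_neg hn

theorem sublatticeProj_eq_self {N M j : ℕ} {h : ell2 N M}
    (hh : ∀ n, ¬ InSublattice j n → h n = 0) : sublatticeProj N M j h = h := by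
  ext1; funext n
  by_cases hn : InSublattice j n
  · exact sublatticeProj_apply_of_mem h hn
  · rw [sublatticeProj_apply_of_notMem h hn, hh n hn]

/-- The point mass at `n` with value `v`. -/
def delta {N M : ℕ} (n : Fin N → ℤ) (v : EuclideanSpace ℂ (Fin M)) : ell2 N M := lp.single 2 n v

theorem delta_apply_self {N M : ℕ} (n : Fin N → ℤ) (v : EuclideanSpace ℂ (Fin M)) :
    delta n v n = v :=
  lp.single_apply_self (E := fun _ : Fin N → ℤ => EuclideanSpace ℂ (Fin M)) 2 n v

theorem delta_apply_ne {N M : ℕ} {n m : Fin N → ℤ} (v : EuclideanSpace ℂ (Fin M)) (h : m ≠ n) :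
    delta n v m = 0 :=
  lp.single_apply_ne (E := fun _ : Fin N → ℤ => EuclideanSpace ℂ (Fin M)) 2 n v h

theorem inner_delta_left {N M : ℕ} (n : Fin N → ℤ) (v : EuclideanSpace ℂ (Fin M))
    (h : ell2 N M) : inner ℂ (delta n v) h = inner ℂ v (h n) :=
  lp.inner_single_left (G := fun _ : Fin N → ℤ => EuclideanSpace ℂ (Fin M)) n v h

theorem sublatticeProj_delta_of_mem {N M j : ℕ} {n : Fin N → ℤ} (hn : InSublattice j n)
    (v : EuclideanSpace ℂ (Fin M)) :
    sublatticeProj N M j (delta n v) = delta n v := by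
  refine sublatticeProj_eq_self fun m hm => delta_apply_ne v ?_
  rintro rfl
  exact hm hn

theorem sublatticeProj_delta_of_notMem {N M j : ℕ} {n : Fin N → ℤ} (hn : ¬ InSublattice j n)
    (v : EuclideanSpace ℂ (Fin M)) : sublatticeProj N M j (delta n v) = 0 := by
  ext1; funext m
  by_cases hm : InSublattice j m
  · rw [sublatticeProj_apply_of_mem _ hm]
    refine delta_apply_ne v ?_
    rintro rfl
    exact hn hm
  · exact sublatticeProj_apply_of_notMem _ hm

/-- A property of `ℓ²` sequences holds everywhere if it holds for the point masses and is closed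
under sums and limits. -/
theorem ell2_induction {N M : ℕ} {p : ell2 N M → Prop}
    (zero : p 0) (point : ∀ n v, p (delta n v))
    (add : ∀ f g, p f → p g → p (f + g)) (closed : IsClosed {h | p h}) (h : ell2 N M) : p h := by
  have hs := lp.hasSum_single (p := 2) (by norm_num) h
  refine closed.mem_of_tendsto hs (Filter.Eventually.of_forall fun s => ?_)
  exact Finset.sum_induction _ p add zero fun n _ => point n _

/-- If two bounded operators into `L²` are related by a matrix-valued multiplier on point masses,
then they are related by it everywhere. -/
theorem ae_eq_sum_smul_of_delta {N M : ℕ} (A B : ell2 N M →L[ℂ] L2M N M)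
    (G : Fin M → (Fin N → ℝ) → EuclideanSpace ℂ (Fin M))
    (hs : ∀ n v, ∀ᵐ k ∂boxMeasure N,
      A (delta n v) k = ∑ b, B (delta n v) k b • G b k) (h : ell2 N M) :
    ∀ᵐ k ∂boxMeasure N, A h k = ∑ b, B h k b • G b k := by
  induction h using ell2_induction with
  | zero =>
    rw [map_zero, map_zero]
    filter_upwards [Lp.coeFn_zero (EuclideanSpace ℂ (Fin M)) 2 (boxMeasure N)] with k hk
    rw [hk]; simp
  | point n v => exact hs n v
  | add f g hf hg =>
    rw [map_add, map_add]
    filter_upwards [hf, hg, Lp.coeFn_add (A f) (A g), Lp.coeFn_add (B f) (B g)] with k h1 h2 h3 h4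
    rw [h3, h4]
    simp only [Pi.add_apply, PiLp.add_apply, h1, h2, add_smul, Finset.sum_add_distrib]
  | closed =>
    refine IsSeqClosed.isClosed fun x h hx hlim => ?_
    have hA : Filter.Tendsto (fun n => A (x n)) Filter.atTop (nhds (A h)) :=
      (A.continuous.tendsto h).comp hlim
    have hB : Filter.Tendsto (fun n => B (x n)) Filter.atTop (nhds (B h)) :=
      (B.continuous.tendsto h).comp hlim
    obtain ⟨φ, hφ, hAφ⟩ := (tendstoInMeasure_of_tendsto_Lp hA).exists_seq_tendsto_ae
    obtain ⟨ψ, hψ, hBψ⟩ := (tendstoInMeasure_of_tendsto_Lp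
      (hB.comp hφ.tendsto_atTop)).exists_seq_tendsto_ae
    filter_upwards [hAφ, hBψ, ae_all_iff.2 hx] with k h1 h2 h3
    refine tendsto_nhds_unique (h1.comp hψ.tendsto_atTop) ?_
    simp only [Function.comp_def, h3]
    refine tendsto_finsetSum _ fun b _ => Filter.Tendsto.smul_const ?_ _
    exact ((EuclideanSpace.proj (𝕜 := ℂ) b).continuous.tendsto _).comp h2

/-- The character `k ↦ e^{i n·k}`. -/
def character {N : ℕ} (n : Fin N → ℤ) (k : Fin N → ℝ) : ℂ :=
  Complex.exp (Complex.I * ∑ i, (n i : ℂ) * (k i : ℂ))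

theorem continuous_character {N : ℕ} (n : Fin N → ℤ) : Continuous (character n) := by
  unfold character; fun_prop

theorem norm_character {N : ℕ} (n : Fin N → ℤ) (k : Fin N → ℝ) : ‖character n k‖ = 1 := by
  have : Complex.I * ∑ i, (n i : ℂ) * (k i : ℂ) = ((∑ i, (n i : ℝ) * k i : ℝ) : ℂ) * Complex.I := by
    push_cast; ring
  rw [character, this, Complex.norm_exp_ofReal_mul_I]

theorem character_add {N : ℕ} (n m : Fin N → ℤ) (k : Fin N → ℝ) :
    character (n + m) k = character n k * character m k := by
  simp only [character, ← Complex.exp_add, ← mul_add, ← Finset.sum_add_distrib]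
  congr 3; funext i; push_cast [Pi.add_apply]; ring

theorem conj_character {N : ℕ} (n : Fin N → ℤ) (k : Fin N → ℝ) :
    (starRingEnd ℂ) (character n k) = character (-n) k := by
  simp [character, ← Complex.exp_conj]

theorem blochFormula_delta {N M : ℕ} (n : Fin N → ℤ) (v : EuclideanSpace ℂ (Fin M))
    (k : Fin N → ℝ) :
    blochFormula (delta n v) k =
      ((2 * Real.pi) ^ ((N : ℝ) / 2))⁻¹ • character n k • v := by
  rw [blochFormula, tsum_eq_single n]
  · rw [delta_apply_self]; rfl
  · intro m hm
    rw [delta_apply_ne v hm, smul_zero]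

instance (N : ℕ) : IsFiniteMeasure (boxMeasure N) :=
  ⟨by
    rw [boxMeasure, Measure.restrict_apply_univ]
    exact (isCompact_univ_pi fun _ => isCompact_Icc).measure_lt_top⟩

/-- A Bloch–Floquet transform is a linear isometry given on finitely supported sequences by the
Fourier series. -/
def IsBlochFloquet {N M : ℕ} (F : ell2 N M ≃ₗᵢ[ℂ] L2M N M) : Prop :=
  ∀ h : ell2 N M, (Function.support ⇑h).Finite → ⇑(F h) =ᵐ[boxMeasure N] blochFormula ⇑h

theorem IsBlochFloquet.apply_delta {N M : ℕ} {F : ell2 N M ≃ₗᵢ[ℂ] L2M N M}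
    (hF : IsBlochFloquet F) (n : Fin N → ℤ) (v : EuclideanSpace ℂ (Fin M)) :
    ⇑(F (delta n v)) =ᵐ[boxMeasure N]
      fun k => ((2 * Real.pi) ^ ((N : ℝ) / 2))⁻¹ • character n k • v := by
  have hfin : (Function.support ⇑(delta n v)).Finite := by
    refine (Set.finite_singleton n).subset fun m hm => ?_
    by_contra hne
    exact hm (delta_apply_ne v hne)
  filter_upwards [hF _ hfin] with k hk
  rw [hk, blochFormula_delta]

/-- The Bloch–Floquet transform turns translations into multiplication by characters. -/
theorem IsBlochFloquet.apply_translate {N M : ℕ} {F : ell2 N M ≃ₗᵢ[ℂ] L2M N M}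
    (hF : IsBlochFloquet F) (n : Fin N → ℤ) {u w : ell2 N M} (huw : ∀ m, w m = u (m - n)) :
    ⇑(F w) =ᵐ[boxMeasure N] fun k => character n k • F u k := by
  have hmem : MemLp (fun k => character n k • F u k) 2 (boxMeasure N) :=
    (Lp.memLp (F u)).of_le
      ((continuous_character n).aestronglyMeasurable.smul (Lp.aestronglyMeasurable _))
      (Filter.Eventually.of_forall fun k => by simp [norm_smul, norm_character])
  suffices h : F w = hmem.toLp by
    rw [h]; exact hmem.coeFn_toLp
  rw [← LinearIsometryEquiv.eq_symm_apply]
  ext1; funext m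
  refine ext_inner_left ℂ fun v => ?_
  rw [← inner_delta_left, ← inner_delta_left,
    ← F.inner_map_map _ (F.symm _), F.apply_symm_apply, inner_delta_left, huw m,
    ← inner_delta_left, ← F.inner_map_map, L2.inner_def, L2.inner_def]
  refine integral_congr_ae ?_
  filter_upwards [hmem.coeFn_toLp, hF.apply_delta m v, hF.apply_delta (m - n) v]
    with k h1 h2 h3
  rw [h1, h2, h3]
  simp only [inner_smul_left, inner_smul_right, RCLike.real_smul_eq_coe_smul (K := ℂ),
    sub_eq_add_neg, character_add, map_mul, conj_character, neg_neg]
  ring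

/-- Replace the first `j` coordinates of `k` by those of `t`. -/
def merge {N : ℕ} (j : ℕ) (t : Fin j → ℝ) (k : Fin N → ℝ) : Fin N → ℝ :=
  fun i => if h : (i : ℕ) < j then t ⟨(i : ℕ), h⟩ else k i

theorem pint_eq_integral {N M : ℕ} (j : ℕ) (f : (Fin N → ℝ) → EuclideanSpace ℂ (Fin M))
    (k : Fin N → ℝ) : pint j f k = ∫ t, f (merge j t k) ∂boxMeasure j := rfl

theorem merge_congr {N : ℕ} {j : ℕ} (t : Fin j → ℝ) {k k' : Fin N → ℝ}
    (h : ∀ i : Fin N, j ≤ (i : ℕ) → k i = k' i) : merge j t k = merge j t k' := by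
  funext i
  by_cases hi : (i : ℕ) < j
  · simp [merge, hi]
  · simp [merge, hi, h i (not_lt.1 hi)]

theorem measurable_merge (N j : ℕ) :
    Measurable fun p : (Fin N → ℝ) × (Fin j → ℝ) => merge j p.2 p.1 := by
  refine measurable_pi_lambda _ fun i => ?_
  by_cases hi : (i : ℕ) < j
  · simp only [merge, hi, dite_true]; fun_prop
  · simp only [merge, hi, dite_false]; fun_prop

theorem boxMeasure_eq_pi (N : ℕ) :
    boxMeasure N = Measure.pi fun _ => volume.restrict (Set.Icc (-Real.pi) Real.pi) :=
  Measure.restrict_pi_pi _ _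

theorem volume_restrict_Icc_univ :
    (volume.restrict (Set.Icc (-Real.pi) Real.pi)) Set.univ = ENNReal.ofReal (2 * Real.pi) := by
  rw [Measure.restrict_apply_univ, Real.volume_Icc]; ring_nf

theorem boxMeasure_univ (N : ℕ) :
    boxMeasure N Set.univ = ENNReal.ofReal (2 * Real.pi) ^ N := by
  rw [boxMeasure_eq_pi, Measure.pi_univ]
  simp only [volume_restrict_Icc_univ, Finset.prod_const, Finset.card_univ, Fintype.card_fin]

theorem map_merge {N j : ℕ} (hj : j ≤ N) :
    ((boxMeasure N).prod (boxMeasure j)).map (fun p => merge j p.2 p.1) =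
      ENNReal.ofReal (2 * Real.pi) ^ j • boxMeasure N := by
  obtain ⟨m, rfl⟩ := Nat.exists_eq_add_of_le hj
  set c : ENNReal := ENNReal.ofReal (2 * Real.pi) ^ j with hc
  have hc0 : c ≠ 0 := pow_ne_zero _ (by simp [Real.pi_pos])
  have hct : c ≠ ⊤ := ENNReal.pow_ne_top ENNReal.ofReal_ne_top
  suffices h : boxMeasure (j + m) =
      c⁻¹ • ((boxMeasure (j + m)).prod (boxMeasure j)).map (fun p => merge j p.2 p.1) by
    conv_rhs => rw [h, smul_smul, ENNReal.mul_inv_cancel hc0 hct, one_smul]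
  rw [boxMeasure_eq_pi]
  refine Measure.pi_eq fun s hs => ?_
  rw [Measure.smul_apply, Measure.map_apply (measurable_merge _ _) (.univ_pi hs)]
  have hpre : (fun p : (Fin (j + m) → ℝ) × (Fin j → ℝ) => merge j p.2 p.1) ⁻¹' Set.univ.pi s =
      (Set.univ.pi fun i : Fin (j + m) => if (i : ℕ) < j then Set.univ else s i) ×ˢ
        (Set.univ.pi fun i : Fin j => s (Fin.castAdd m i)) := by
    ext p
    simp only [Set.mem_preimage, Set.mem_pi, Set.mem_univ, true_imp_iff, Set.mem_prod,
      Fin.forall_fin_add, merge, Fin.val_castAdd, Fin.is_lt, Fin.val_natAdd,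
      dite_true, if_true, Nat.not_lt.2 (Nat.le_add_right j _), dite_false, if_false]
    simp [and_comm]
  rw [hpre, Measure.prod_prod, boxMeasure_eq_pi, Measure.pi_pi, Measure.pi_pi, Fin.prod_univ_add,
    Fin.prod_univ_add]
  simp only [Fin.val_castAdd, Fin.is_lt, Fin.val_natAdd, if_true,
    Nat.not_lt.2 (Nat.le_add_right j _), if_false, volume_restrict_Icc_univ, Finset.prod_const,
    Finset.card_univ, Fintype.card_fin, ← hc, smul_eq_mul]
  rw [mul_assoc, ← mul_assoc, ENNReal.inv_mul_cancel hc0 hct, one_mul, mul_comm]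

theorem quasiMeasurePreserving_merge {N j : ℕ} (hj : j ≤ N) :
    Measure.QuasiMeasurePreserving (fun p : (Fin N → ℝ) × (Fin j → ℝ) => merge j p.2 p.1)
      ((boxMeasure N).prod (boxMeasure j)) (boxMeasure N) :=
  ⟨measurable_merge N j, by rw [map_merge hj]; exact Measure.smul_absolutelyContinuous⟩

theorem pint_congr_ae {N M j : ℕ} (hj : j ≤ N) {f g : (Fin N → ℝ) → EuclideanSpace ℂ (Fin M)}
    (h : f =ᵐ[boxMeasure N] g) : pint j f =ᵐ[boxMeasure N] pint j g := by
  filter_upwards [Measure.ae_ae_of_ae_prod ((quasiMeasurePreserving_merge hj).ae h)] with k hk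
  rw [pint_eq_integral, pint_eq_integral]
  exact integral_congr_ae hk

theorem integrable_comp_merge {N M j : ℕ} (hj : j ≤ N)
    {f : (Fin N → ℝ) → EuclideanSpace ℂ (Fin M)} (hf : Integrable f (boxMeasure N)) :
    Integrable (fun p : (Fin N → ℝ) × (Fin j → ℝ) => f (merge j p.2 p.1))
      ((boxMeasure N).prod (boxMeasure j)) := by
  refine Integrable.comp_measurable ?_ (measurable_merge N j)
  rw [map_merge hj]
  exact hf.smul_measure (ENNReal.pow_ne_top ENNReal.ofReal_ne_top)

theorem aestronglyMeasurable_pint {N M j : ℕ} (hj : j ≤ N)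
    {f : (Fin N → ℝ) → EuclideanSpace ℂ (Fin M)} (hf : Integrable f (boxMeasure N)) :
    AEStronglyMeasurable (pint j f) (boxMeasure N) :=
  (integrable_comp_merge hj hf).aestronglyMeasurable.integral_prod_right'

theorem pint_add_ae {N M j : ℕ} (hj : j ≤ N) {f g : (Fin N → ℝ) → EuclideanSpace ℂ (Fin M)}
    (hf : Integrable f (boxMeasure N)) (hg : Integrable g (boxMeasure N)) :
    pint j (f + g) =ᵐ[boxMeasure N] pint j f + pint j g := by
  filter_upwards [(integrable_comp_merge hj hf).prod_right_ae,
    (integrable_comp_merge hj hg).prod_right_ae] with k h1 h2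
  exact integral_add h1 h2

theorem eLpNorm_pint_le {N M j : ℕ} (hj : j ≤ N)
    {f : (Fin N → ℝ) → EuclideanSpace ℂ (Fin M)} (hf : Integrable f (boxMeasure N)) :
    eLpNorm (pint j f) 1 (boxMeasure N) ≤
      ENNReal.ofReal (2 * Real.pi) ^ j * eLpNorm f 1 (boxMeasure N) := by
  have hm : AEMeasurable (fun x => ‖f x‖ₑ)
      (((boxMeasure N).prod (boxMeasure j)).map fun p => merge j p.2 p.1) := by
    rw [map_merge hj]
    exact hf.aestronglyMeasurable.enorm.smul_measure _
  simp only [eLpNorm_one_eq_lintegral_enorm]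
  calc ∫⁻ k, ‖pint j f k‖ₑ ∂boxMeasure N
      ≤ ∫⁻ k, ∫⁻ t, ‖f (merge j t k)‖ₑ ∂boxMeasure j ∂boxMeasure N :=
        lintegral_mono fun k => enorm_integral_le_lintegral_enorm _
    _ = ∫⁻ p : (Fin N → ℝ) × (Fin j → ℝ), ‖f (merge j p.2 p.1)‖ₑ
          ∂(boxMeasure N).prod (boxMeasure j) :=
        (lintegral_prod _ (integrable_comp_merge hj hf).aestronglyMeasurable.enorm).symm
    _ = ENNReal.ofReal (2 * Real.pi) ^ j * ∫⁻ k, ‖f k‖ₑ ∂boxMeasure N := by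
        rw [← lintegral_map' hm (measurable_merge N j).aemeasurable, map_merge hj,
          lintegral_smul_measure, smul_eq_mul]

theorem integral_exp_Icc {n : ℤ} (hn : n ≠ 0) :
    ∫ t in Set.Icc (-Real.pi) Real.pi, Complex.exp (Complex.I * (n * t)) = 0 := by
  have hc : Complex.I * n ≠ 0 := mul_ne_zero Complex.I_ne_zero (by exact_mod_cast hn)
  rw [integral_Icc_eq_integral_Ioc, ← intervalIntegral.integral_of_le (by linarith [Real.pi_pos])]
  simp only [← mul_assoc]
  rw [integral_exp_mul_complex hc, div_eq_zero_iff]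
  left
  rw [sub_eq_zero, Complex.exp_eq_exp_iff_exists_int]
  exact ⟨n, by push_cast; ring⟩

theorem character_merge_of_mem {N j : ℕ} {n : Fin N → ℤ} (hn : InSublattice j n)
    (t : Fin j → ℝ) (k : Fin N → ℝ) : character n (merge j t k) = character n k := by
  unfold character
  congr 2
  refine Finset.sum_congr rfl fun i _ => ?_
  by_cases hi : (i : ℕ) < j
  · simp [hn i hi]
  · simp [merge, hi]

theorem integral_character_merge_of_notMem {N j : ℕ} (hj : j ≤ N) {n : Fin N → ℤ}
    (hn : ¬ InSublattice j n) (k : Fin N → ℝ) :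
    ∫ t, character n (merge j t k) ∂boxMeasure j = 0 := by
  obtain ⟨m, rfl⟩ := Nat.exists_eq_add_of_le hj
  obtain ⟨i, hi, hni⟩ : ∃ i : Fin (j + m), (i : ℕ) < j ∧ n i ≠ 0 := by
    simpa [InSublattice] using hn
  have hprod : ∀ t : Fin j → ℝ, character n (merge j t k) =
      (∏ i : Fin j, Complex.exp (Complex.I * (n (Fin.castAdd m i) * t i))) *
        Complex.exp (Complex.I * ∑ i : Fin m, (n (Fin.natAdd j i) : ℂ) * k (Fin.natAdd j i)) := by
    intro t
    rw [← Complex.exp_sum, ← Complex.exp_add, ← Finset.mul_sum, ← mul_add, character,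
      Fin.sum_univ_add]
    simp [merge]
  simp only [hprod]
  rw [integral_mul_const, boxMeasure_eq_pi, integral_fintype_prod_eq_prod (𝕜 := ℂ)
    (fun i (x : ℝ) => Complex.exp (Complex.I * (n (Fin.castAdd m i) * x))),
    Finset.prod_eq_zero (Finset.mem_univ ⟨i, hi⟩) (integral_exp_Icc hni), zero_mul]

theorem boxMeasure_real_univ (j : ℕ) : (boxMeasure j).real Set.univ = (2 * Real.pi) ^ j := by
  rw [measureReal_def, boxMeasure_univ, ENNReal.toReal_pow,
    ENNReal.toReal_ofReal (by positivity)]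

theorem pint_of_invariant {N M j : ℕ} {f : (Fin N → ℝ) → EuclideanSpace ℂ (Fin M)}
    (hf : ∀ t k, f (merge j t k) = f k) (k : Fin N → ℝ) :
    pint j f k = (2 * Real.pi) ^ j • f k := by
  simp only [pint_eq_integral, hf, integral_const, boxMeasure_real_univ]

theorem L2M.integrable {N M : ℕ} (f : L2M N M) : Integrable f (boxMeasure N) :=
  (Lp.memLp f).integrable (by norm_num)

theorem L2M.eLpNorm_one_le {N M : ℕ} (f : L2M N M) :
    eLpNorm f 1 (boxMeasure N) ≤
      ENNReal.ofReal ‖f‖ *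
        boxMeasure N Set.univ ^ (1 / (1 : ENNReal).toReal - 1 / (2 : ENNReal).toReal) := by
  rw [Lp.norm_def, ENNReal.ofReal_toReal (Lp.eLpNorm_ne_top f)]
  exact eLpNorm_le_eLpNorm_mul_rpow_measure_univ (by norm_num) (Lp.aestronglyMeasurable f)

/-- Partial integration over the first `j` quasi-momenta corresponds to restriction to the
sublattice `{n : n₁ = ⋯ = n_j = 0}`. -/
theorem IsBlochFloquet.pint_apply {N M j : ℕ} (hj : j ≤ N) {F : ell2 N M ≃ₗᵢ[ℂ] L2M N M}
    (hF : IsBlochFloquet F) (h : ell2 N M) :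
    pint j (F h) =ᵐ[boxMeasure N] fun k => (2 * Real.pi) ^ j • F (sublatticeProj N M j h) k := by
  have apply_add : ∀ f g : ell2 N M,
      pint j (F (f + g)) =ᵐ[boxMeasure N] pint j (F f) + pint j (F g) := fun f g => by
    rw [map_add]
    exact (pint_congr_ae hj (Lp.coeFn_add (F f) (F g))).trans
      (pint_add_ae hj (L2M.integrable _) (L2M.integrable _))
  have apply_proj_add : ∀ f g : ell2 N M, ∀ᵐ k ∂boxMeasure N, F (sublatticeProj N M j (f + g)) k =
      F (sublatticeProj N M j f) k + F (sublatticeProj N M j g) k := fun f g => by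
    rw [map_add, map_add]
    exact Lp.coeFn_add _ _
  induction h using ell2_induction with
  | zero =>
    rw [map_zero, map_zero]
    have h0 := Lp.coeFn_zero (EuclideanSpace ℂ (Fin M)) 2 (boxMeasure N)
    filter_upwards [pint_congr_ae hj h0, h0] with k h1 h2
    rw [h1, map_zero, h2, pint_of_invariant (fun _ _ => rfl)]
  | point n v =>
    filter_upwards [pint_congr_ae hj (hF.apply_delta n v), hF.apply_delta n v,
      Lp.coeFn_zero (EuclideanSpace ℂ (Fin M)) 2 (boxMeasure N)] with k h1 h2 h3
    rw [h1]
    by_cases hn : InSublattice j n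
    · rw [pint_of_invariant fun t k => by rw [character_merge_of_mem hn],
        sublatticeProj_delta_of_mem hn, h2]
    · rw [sublatticeProj_delta_of_notMem hn, map_zero, h3, pint_eq_integral, integral_smul,
        integral_smul_const, integral_character_merge_of_notMem hj hn]
      simp
  | add f g hf hg =>
    filter_upwards [apply_add f g, apply_proj_add f g, hf, hg] with k h1 h2 h3 h4
    rw [h1, Pi.add_apply, h2, h3, h4, smul_add]
  | closed =>
    let D : ell2 N M → (Fin N → ℝ) → EuclideanSpace ℂ (Fin M) := fun h =>
      pint j (F h) - (2 * Real.pi) ^ j • ⇑(F (sublatticeProj N M j h))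
    have hDm : ∀ h, AEStronglyMeasurable (D h) (boxMeasure N) := fun h =>
      (aestronglyMeasurable_pint hj (L2M.integrable _)).sub
        ((Lp.aestronglyMeasurable _).const_smul _)
    obtain ⟨K, hK, hDle⟩ : ∃ K : ENNReal, K ≠ ⊤ ∧
        ∀ h, eLpNorm (D h) 1 (boxMeasure N) ≤ K * ENNReal.ofReal ‖h‖ := by
      set c : ENNReal := ENNReal.ofReal (2 * Real.pi) ^ j with hc
      set V : ENNReal :=
        boxMeasure N Set.univ ^ (1 / (1 : ENNReal).toReal - 1 / (2 : ENNReal).toReal) with hV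
      have hct : c ≠ ⊤ := ENNReal.pow_ne_top ENNReal.ofReal_ne_top
      have hVt : V ≠ ⊤ := ENNReal.rpow_ne_top_of_nonneg (by norm_num) (measure_ne_top _ _)
      refine ⟨c * V + c * V * ENNReal.ofReal ‖sublatticeProj N M j‖,
        by finiteness, fun h => ?_⟩
      have e1 : eLpNorm (pint j (F h)) 1 (boxMeasure N) ≤ c * (ENNReal.ofReal ‖h‖ * V) := by
        refine (eLpNorm_pint_le hj (L2M.integrable _)).trans ?_
        have := L2M.eLpNorm_one_le (F h)
        rw [LinearIsometryEquiv.norm_map] at this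
        gcongr
      have e2 : eLpNorm ((2 * Real.pi) ^ j • ⇑(F (sublatticeProj N M j h))) 1 (boxMeasure N) ≤
          c * (ENNReal.ofReal (‖sublatticeProj N M j‖ * ‖h‖) * V) := by
        have hcn : ‖((2 * Real.pi) ^ j : ℝ)‖ₑ = c := by
          rw [Real.enorm_eq_ofReal (by positivity), ENNReal.ofReal_pow (by positivity)]
        rw [eLpNorm_const_smul, hcn]
        have := L2M.eLpNorm_one_le (F (sublatticeProj N M j h))
        rw [LinearIsometryEquiv.norm_map] at this
        refine mul_le_mul_right (this.trans ?_) _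
        gcongr
        exact (sublatticeProj N M j).le_opNorm h
      refine (eLpNorm_sub_le (aestronglyMeasurable_pint hj (L2M.integrable _))
        ((Lp.aestronglyMeasurable _).const_smul _) le_rfl).trans ((add_le_add e1 e2).trans ?_)
      rw [ENNReal.ofReal_mul (norm_nonneg _)]
      apply le_of_eq
      ring
    refine IsSeqClosed.isClosed fun x h hx hlim => ?_
    have hD : ∀ n, D h =ᵐ[boxMeasure N] D (h - x n) := fun n => by
      have e1 := apply_add (h - x n) (x n)
      have e2 := apply_proj_add (h - x n) (x n)
      rw [sub_add_cancel] at e1 e2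
      filter_upwards [e1, e2, hx n] with k h1 h2 h3
      simp only [D, Pi.sub_apply, Pi.smul_apply, h1, h2, Pi.add_apply, h3, smul_add]
      abel
    have hle : ∀ n, eLpNorm (D h) 1 (boxMeasure N) ≤ K * ENNReal.ofReal ‖h - x n‖ := fun n => by
      rw [eLpNorm_congr_ae (hD n)]
      exact hDle _
    have hnorm : Filter.Tendsto (fun n => ‖h - x n‖) Filter.atTop (nhds 0) := by
      simpa using (hlim.const_sub h).norm
    have hto : Filter.Tendsto (fun n => K * ENNReal.ofReal ‖h - x n‖) Filter.atTop (nhds 0) := by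
      simpa using ENNReal.Tendsto.const_mul (ENNReal.tendsto_ofReal hnorm) (Or.inr hK)
    have hz : eLpNorm (D h) 1 (boxMeasure N) = 0 := le_antisymm
      (ge_of_tendsto hto (Filter.Eventually.of_forall hle)) zero_le
    filter_upwards [(eLpNorm_eq_zero_iff (hDm h) one_ne_zero).1 hz] with k hk
    exact sub_eq_zero.1 hk

theorem navg_congr_ae {N M j : ℕ} (hj : j ≤ N) {f g : (Fin N → ℝ) → EuclideanSpace ℂ (Fin M)}
    (h : f =ᵐ[boxMeasure N] g) : navg j f =ᵐ[boxMeasure N] navg j g := by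
  filter_upwards [pint_congr_ae hj h] with k hk
  rw [navg, navg, hk]

theorem navg_congr {N M j : ℕ} (f : (Fin N → ℝ) → EuclideanSpace ℂ (Fin M)) {k k' : Fin N → ℝ}
    (h : ∀ i : Fin N, j ≤ (i : ℕ) → k i = k' i) : navg j f k = navg j f k' := by
  rw [navg, navg, pint_eq_integral, pint_eq_integral]
  simp only [merge_congr _ h]

theorem inv_rpow_half_smul_pow_smul {E : Type*} [AddCommGroup E] [Module ℝ E] (j : ℕ) (x : E) :
    ((2 * Real.pi) ^ ((j : ℝ) / 2))⁻¹ • (2 * Real.pi) ^ j • x =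
      ((2 * Real.pi) ^ ((j : ℝ) / 2)) • x := by
  have h2 : (0 : ℝ) < 2 * Real.pi := by positivity
  rw [smul_smul, ← Real.rpow_neg h2.le, ← Real.rpow_natCast, ← Real.rpow_add h2]
  congr 2
  ring

theorem navg_of_invariant {N M j : ℕ} {f : (Fin N → ℝ) → EuclideanSpace ℂ (Fin M)}
    (hf : ∀ t k, f (merge j t k) = f k) (k : Fin N → ℝ) :
    navg j f k = ((2 * Real.pi) ^ ((j : ℝ) / 2)) • f k := by
  rw [navg, pint_of_invariant hf, inv_rpow_half_smul_pow_smul]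

theorem IsBlochFloquet.navg_apply {N M j : ℕ} (hj : j ≤ N) {F : ell2 N M ≃ₗᵢ[ℂ] L2M N M}
    (hF : IsBlochFloquet F) (h : ell2 N M) :
    navg j (F h) =ᵐ[boxMeasure N]
      fun k => ((2 * Real.pi) ^ ((j : ℝ) / 2)) • F (sublatticeProj N M j h) k := by
  filter_upwards [hF.pint_apply hj h] with k hk
  rw [navg, hk, inv_rpow_half_smul_pow_smul]

theorem aestronglyMeasurable_navg {N M j : ℕ} (hj : j ≤ N)
    {f : (Fin N → ℝ) → EuclideanSpace ℂ (Fin M)} (hf : Integrable f (boxMeasure N)) :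
    AEStronglyMeasurable (navg j f) (boxMeasure N) :=
  (aestronglyMeasurable_pint hj hf).const_smul ((2 * Real.pi) ^ ((j : ℝ) / 2))⁻¹

theorem delta_eq_sum {N M : ℕ} (n : Fin N → ℤ) (v : EuclideanSpace ℂ (Fin M)) :
    (delta n v : ell2 N M) = ∑ b, v b • delta n (EuclideanSpace.single b 1) := by
  let L := lp.lsingle (𝕜 := ℂ) (E := fun _ : Fin N → ℤ => EuclideanSpace ℂ (Fin M)) 2 n
  have hv : v = ∑ b, v b • EuclideanSpace.single b (1 : ℂ) := by
    ext a; simp [Finset.sum_apply, Pi.single_apply]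
  have := congrArg L hv
  rw [map_sum] at this
  simp only [map_smul] at this
  exact this

theorem L2M.coeFn_sum_smul {N M : ℕ} {ι : Type*} (s : Finset ι) (c : ι → ℂ) (g : ι → L2M N M) :
    ∀ᵐ k ∂boxMeasure N, (∑ b ∈ s, c b • g b : L2M N M) k = ∑ b ∈ s, c b • g b k := by
  classical
  induction s using Finset.induction_on with
  | empty =>
    simp only [Finset.sum_empty]
    exact Lp.coeFn_zero _ _ _
  | insert b s hb ih =>
    rw [Finset.sum_insert hb]
    filter_upwards [ih, Lp.coeFn_add (c b • g b) (∑ b ∈ s, c b • g b),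
      Lp.coeFn_smul (c b) (g b)] with k h1 h2 h3
    rw [Finset.sum_insert hb, h2, Pi.add_apply, h3, Pi.smul_apply, h1]

/-- An operator that factors through the sublattice and commutes with its translations acts as
multiplication by the transforms of its columns. -/
theorem IsBlochFloquet.apply_of_translation_invariant {N M j : ℕ}
    {F : ell2 N M ≃ₗᵢ[ℂ] L2M N M} (hF : IsBlochFloquet F) {T : ell2 N M →L[ℂ] ell2 N M}
    (hTzero : ∀ n, ¬ InSublattice j n → ∀ v, T (delta n v) = 0)
    (hTshift : ∀ n, InSublattice j n → ∀ v m, T (delta n v) m = T (delta 0 v) (m - n))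
    (h : ell2 N M) :
    ∀ᵐ k ∂boxMeasure N, F (T h) k = ∑ b, F (sublatticeProj N M j h) k b •
      ((2 * Real.pi) ^ ((N : ℝ) / 2)) • F (T (delta 0 (EuclideanSpace.single b 1))) k := by
  refine ae_eq_sum_smul_of_delta (F.toContinuousLinearEquiv.toContinuousLinearMap ∘L T)
    (F.toContinuousLinearEquiv.toContinuousLinearMap ∘L sublatticeProj N M j)
    (fun b k => ((2 * Real.pi) ^ ((N : ℝ) / 2)) • F (T (delta 0 (EuclideanSpace.single b 1))) k)
    (fun n v => ?_) h
  change ∀ᵐ k ∂boxMeasure N, F (T (delta n v)) k = ∑ b, F (sublatticeProj N M j (delta n v)) k b •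
      ((2 * Real.pi) ^ ((N : ℝ) / 2)) • F (T (delta 0 (EuclideanSpace.single b 1))) k
  by_cases hn : InSublattice j n
  · have hsum := L2M.coeFn_sum_smul (N := N) (M := M) Finset.univ v
      fun b => F (T (delta 0 (EuclideanSpace.single b 1)))
    have hFT : F (T (delta 0 v)) =
        ∑ b, v b • F (T (delta 0 (EuclideanSpace.single b 1))) := by
      rw [delta_eq_sum 0 v, map_sum, map_sum]
      simp only [map_smul]
    rw [← hFT] at hsum
    rw [sublatticeProj_delta_of_mem hn]
    filter_upwards [hF.apply_delta n v, hF.apply_translate n (hTshift n hn v), hsum]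
      with k h1 h2 h3
    rw [h1, h2, h3, Finset.smul_sum]
    refine Finset.sum_congr rfl fun b _ => ?_
    have hc : ((2 * Real.pi) ^ ((N : ℝ) / 2)) ≠ 0 := by positivity
    rw [PiLp.smul_apply, PiLp.smul_apply, smul_comm _ ((2 * Real.pi) ^ ((N : ℝ) / 2)) _,
      smul_assoc, smul_inv_smul₀ hc, smul_smul, smul_eq_mul]
  · rw [sublatticeProj_delta_of_notMem hn, hTzero n hn, map_zero]
    filter_upwards [Lp.coeFn_zero (EuclideanSpace ℂ (Fin M)) 2 (boxMeasure N)] with k hk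
    rw [hk]
    simp

/-- The columns of a partial-average multiplier of a bounded operator are essentially bounded. -/
theorem ae_norm_le_of_bounded_navg_multiplier {N M j : ℕ} (hj : j ≤ N)
    (A : L2M N M →L[ℂ] L2M N M) {H : Fin M → (Fin N → ℝ) → EuclideanSpace ℂ (Fin M)}
    (hHm : ∀ b, AEStronglyMeasurable (H b) (boxMeasure N))
    (hH : ∀ b t k, H b (merge j t k) = H b k)
    (hA : ∀ f, ∀ᵐ k ∂boxMeasure N, A f k = ∑ b, navg j f k b • H b k) (b : Fin M) :
    ∀ᵐ k ∂boxMeasure N, ‖H b k‖ ≤ (‖A‖ + 1) / (2 * Real.pi) ^ ((j : ℝ) / 2) := by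
  set d : ℝ := (2 * Real.pi) ^ ((j : ℝ) / 2) with hd
  have hd0 : 0 < d := by positivity
  set E : Set (Fin N → ℝ) := {k | (‖A‖ + 1) / d < ‖H b k‖} with hE
  have hEm : NullMeasurableSet E (boxMeasure N) :=
    nullMeasurableSet_lt aemeasurable_const (hHm b).norm.aemeasurable
  set φ : (Fin N → ℝ) → EuclideanSpace ℂ (Fin M) :=
    E.indicator fun _ => EuclideanSpace.single b 1 with hφ
  have hφinv : ∀ t k, φ (merge j t k) = φ k := fun t k => by
    have : merge j t k ∈ E ↔ k ∈ E := by simp only [hE, Set.mem_ofPred_eq, hH]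
    by_cases hk : k ∈ E
    · simp [hφ, hk, this.2 hk]
    · simp [hφ, hk, this.not.2 hk]
  have hφmem : MemLp φ 2 (boxMeasure N) :=
    MemLp.of_bound (aestronglyMeasurable_const.indicator₀ hEm) 1
      (Filter.Eventually.of_forall fun k => by
        by_cases hk : k ∈ E <;> simp [hφ, hk])
  set f : L2M N M := hφmem.toLp with hf
  have hfφ : f =ᵐ[boxMeasure N] φ := hφmem.coeFn_toLp
  have hAf : ∀ᵐ k ∂boxMeasure N, ‖f k‖ ≤ (‖A‖ + 1)⁻¹ * ‖A f k‖ := by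
    filter_upwards [hA f, navg_congr_ae hj hfφ, hfφ] with k h1 h2 h3
    rw [h3, h1, h2, navg_of_invariant hφinv]
    by_cases hk : k ∈ E
    · have hφk : φ k = EuclideanSpace.single b 1 := Set.indicator_of_mem hk _
      have hsum : ∑ b', (d • φ k) b' • H b' k = (d : ℂ) • H b k := by
        rw [Finset.sum_eq_single b]
        · simp [hφk]
        · intro b' _ hb'
          simp [hφk, hb']
        · simp
      have hk' : ‖A‖ + 1 < ‖H b k‖ * d := (div_lt_iff₀ hd0).1 hk
      rw [hsum, hφk, norm_smul, Complex.norm_real, Real.norm_of_nonneg hd0.le,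
        PiLp.norm_single, norm_one, ← div_eq_inv_mul, one_le_div (by positivity)]
      linarith
    · have hφk : φ k = 0 := Set.indicator_of_notMem hk _
      rw [hφk, norm_zero]
      positivity
  have hle := Lp.norm_le_mul_norm_of_ae_le_mul hAf
  have hf0 : f = 0 := by
    have h1 := hle.trans (mul_le_mul_of_nonneg_left (A.le_opNorm f) (by positivity))
    rw [← div_eq_inv_mul, le_div_iff₀ (by positivity)] at h1
    exact norm_le_zero_iff.1 (by linarith)
  rw [hf0] at hfφ
  filter_upwards [hfφ, Lp.coeFn_zero (EuclideanSpace ℂ (Fin M)) 2 (boxMeasure N)] with k h1 h2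
  by_contra hk
  have hφk : φ k = EuclideanSpace.single b 1 := Set.indicator_of_mem (show k ∈ E from not_le.1 hk) _
  rw [h2, hφk] at h1
  have := congrArg norm h1
  simp at this

/-- Proposition 3.1(i): let `𝒜_j` be a bounded operator on `ℓ²(ℤ^N, ℂ^M)`
with `P_j 𝒜_j P_j = 𝒜_j` (encoded by: the range lies in functions supported on the
sublattice `{n : n₁ = ⋯ = n_j = 0}`, and `𝒜_j ∘ P_j = 𝒜_j`) which commutes with the
shifts `S_n` for all `n` in the sublattice. Then there is a matrix-valued function
`A_j(k)`, with essentially bounded entries and not depending on `k₁,…,k_j`, such that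
`(F 𝒜_j F⁻¹ f̂)(k) = A_j(k) ⟨f̂⟩_{1…j}` for a.e. `k`. -/
theorem sublattice_periodic_operator_symbol (N M : ℕ) (hN : 0 < N) (hM : 0 < M)
    (j : ℕ) (hj1 : 1 ≤ j) (hjN : j ≤ N)
    (F : ell2 N M ≃ₗᵢ[ℂ] L2M N M)
    (hF : ∀ h : ell2 N M, (Function.support ⇑h).Finite →
      ⇑(F h) =ᵐ[boxMeasure N] blochFormula ⇑h)
    (T : ell2 N M →L[ℂ] ell2 N M)
    (hrange : ∀ (h : ell2 N M) (n : Fin N → ℤ),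
      ¬ (∀ i : Fin N, (i : ℕ) < j → n i = 0) → (T h) n = 0)
    (hTP : ∀ h g : ell2 N M,
      (∀ n : Fin N → ℤ, g n = if ∀ i : Fin N, (i : ℕ) < j → n i = 0 then h n else 0) →
      T g = T h)
    (hshift : ∀ n : Fin N → ℤ, (∀ i : Fin N, (i : ℕ) < j → n i = 0) →
      ∀ f g : ell2 N M, (∀ m, g m = f (m + n)) → ∀ m, (T g) m = (T f) (m + n)) :
    ∃ Aj : (Fin N → ℝ) → Matrix (Fin M) (Fin M) ℂ,
      (∃ C : ℝ, ∀ a b : Fin M, ∀ᵐ k ∂(boxMeasure N), ‖Aj k a b‖ ≤ C) ∧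
      (∀ k k' : Fin N → ℝ, (∀ i : Fin N, j ≤ (i : ℕ) → k i = k' i) → Aj k = Aj k') ∧
      ∀ f : L2M N M, ∀ᵐ k ∂(boxMeasure N), ∀ a : Fin M,
        (F (T (F.symm f))) k a = ∑ b : Fin M, Aj k a b * navg j (⇑f) k b := by
  have hF' : IsBlochFloquet F := hF
  have hTzero : ∀ n, ¬ InSublattice j n → ∀ v, T (delta n v) = 0 := fun n hn v => by
    rw [← hTP (delta n v) 0 fun m => ?_, map_zero]
    split_ifs with hm
    · exact (delta_apply_ne v (by rintro rfl; exact hn hm)).symm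
    · rfl
  have hTshift : ∀ n, InSublattice j n → ∀ v m, T (delta n v) m = T (delta 0 v) (m - n) :=
    fun n hn v m => by
      rw [hshift n hn (delta n v) (delta 0 v) (fun m => ?_) (m - n), sub_add_cancel]
      by_cases hm : m = 0
      · rw [hm, zero_add, delta_apply_self, delta_apply_self]
      · rw [delta_apply_ne v hm, delta_apply_ne v (by simpa using hm)]
  set d : ℝ := (2 * Real.pi) ^ ((j : ℝ) / 2) with hd
  have hd0 : d ≠ 0 := by positivity
  set c : ℝ := (2 * Real.pi) ^ ((N : ℝ) / 2) with hc
  set G : Fin M → L2M N M := fun b => F (T (delta 0 (EuclideanSpace.single b 1))) with hG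
  set H : Fin M → (Fin N → ℝ) → EuclideanSpace ℂ (Fin M) :=
    fun b k => (c * d⁻¹ * d⁻¹) • navg j (G b) k with hH
  have hHG : ∀ b, H b =ᵐ[boxMeasure N] fun k => d⁻¹ • c • G b k := fun b => by
    filter_upwards [hF'.navg_apply hjN (T (delta 0 (EuclideanSpace.single b 1)))] with k hk
    simp only [hH, hG]
    rw [hk, sublatticeProj_eq_self fun n hn => hrange _ n hn, smul_smul, smul_smul, ← hd]
    congr 1
    field_simp
  have hHcongr : ∀ b (k k' : Fin N → ℝ), (∀ i : Fin N, j ≤ (i : ℕ) → k i = k' i) →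
      H b k = H b k' := fun b k k' hk => by
    simp only [hH, navg_congr _ hk]
  have hHm : ∀ b, AEStronglyMeasurable (H b) (boxMeasure N) := fun b =>
    (aestronglyMeasurable_navg hjN (L2M.integrable (G b))).const_smul (c * d⁻¹ * d⁻¹)
  have hHinv : ∀ b t k, H b (merge j t k) = H b k := fun b t k =>
    hHcongr b _ _ fun i hi => by simp [merge, not_lt.2 hi]
  clear_value H
  have key : ∀ f : L2M N M, ∀ᵐ k ∂boxMeasure N,
      F (T (F.symm f)) k = ∑ b, navg j f k b • H b k := fun f => by
    have hnavg := hF'.navg_apply hjN (F.symm f)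
    rw [F.apply_symm_apply] at hnavg
    filter_upwards [hF'.apply_of_translation_invariant hTzero hTshift (F.symm f), hnavg,
      ae_all_iff.2 hHG] with k h1 h2 h3
    rw [h1, h2]
    refine Finset.sum_congr rfl fun b _ => ?_
    rw [h3, PiLp.smul_apply, smul_assoc, smul_comm _ d⁻¹, smul_inv_smul₀ hd0]
  let A : L2M N M →L[ℂ] L2M N M :=
    F.toContinuousLinearEquiv.toContinuousLinearMap ∘L T ∘L
      F.symm.toContinuousLinearEquiv.toContinuousLinearMap
  refine ⟨fun k a b => H b k a, ⟨(‖A‖ + 1) / d, fun a b => ?_⟩, fun k k' hk => ?_, fun f => ?_⟩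
  · filter_upwards [ae_norm_le_of_bounded_navg_multiplier hjN A
      hHm hHinv key b] with k hk
    exact (PiLp.norm_apply_le (H b k) a).trans hk
  · funext a b
    simp only [hHcongr b k k' hk]
  · filter_upwards [key f] with k hk a
    rw [hk, WithLp.ofLp_sum, Finset.sum_apply]
    exact Finset.sum_congr rfl fun b _ => mul_comm _ _
end
end
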